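/- Let 0 → V₁ → V₂ → V₃ → 0 be a short exact sequence of finite-dimensional modules over a group B (or of B-representations). Then the Koszul complex 0 → S^{n-d}V₂* ⊗ ∧^d V₃* → ... → S^{n-1}V₂* ⊗ V₃* → S^n V₂* → S^n V₁* → 0 is exact for every n ≥ 0, where d = dim V₃. -/

import Mathlib

open scoped TensorProduct

namespace KoszulAux

lemma exists_perm_of_ofFn_perm {m k : ℕ} (w w' : Fin k → Fin m)
    (h : (List.ofFn w).Perm (List.ofFn w')) : ∃ σ : Equiv.Perm (Fin k), w' = w ∘ σ := by
  have h2 : w ∘ Tuple.sort w = w' ∘ Tuple.sort w' := by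
    apply List.ofFn_injective
    refine List.Perm.eq_of_pairwise' (r := (· ≤ ·)) (show Monotone (w ∘ Tuple.sort w) from Tuple.monotone_sort w).sortedLE_ofFn.pairwise
      (show Monotone (w' ∘ Tuple.sort w') from Tuple.monotone_sort w').sortedLE_ofFn.pairwise ?_
    exact ((Tuple.sort w).ofFn_comp_perm w).trans
      (h.trans ((Tuple.sort w').ofFn_comp_perm w').symm)
  refine ⟨(Tuple.sort w').symm.trans (Tuple.sort w), ?_⟩
  funext i
  have := congrFun h2 ((Tuple.sort w').symm i)
  simpa using this.symm

section gens
variable {A : Type} [AddCommGroup A] [Module ℂ A] 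
  {M : Type} [AddCommGroup M] [Module ℂ M]

lemma span_gen_of_span {k : ℕ} (g : MultilinearMap ℂ (fun _ : Fin k => A) M)
    (hspan : Submodule.span ℂ (Set.range g) = ⊤) (P : Set A)
    (hP : Submodule.span ℂ P = ⊤) :
    Submodule.span ℂ {x | ∃ f : Fin k → A, (∀ i, f i ∈ P) ∧ g f = x} = ⊤ := by
  set Q := Submodule.span ℂ {x | ∃ f : Fin k → A, (∀ i, f i ∈ P) ∧ g f = x} with hQ
  have h0 : Q.mkQ.compMultilinearMap g = 0 := by
    refine Module.Basis.ext_multilinear (fun _ => Module.Basis.ofSpan hP.ge) ?_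
    intro v
    simp only [LinearMap.compMultilinearMap_apply, zero_apply,
      Submodule.mkQ_apply, Submodule.Quotient.mk_eq_zero]
    apply Submodule.subset_span
    exact ⟨_, fun i => Module.Basis.ofSpan_subset hP.ge ⟨_, rfl⟩, rfl⟩
  rw [eq_top_iff, ← hspan, Submodule.span_le]
  rintro _ ⟨f, rfl⟩
  have := congrArg (fun G => G f) h0
  simpa using this

lemma exists_lift [FiniteDimensional ℂ A] {k : ℕ} [FiniteDimensional ℂ M]
    (g : MultilinearMap ℂ (fun _ : Fin k => A) M)
    (hsym : ∀ (σ : Equiv.Perm (Fin k)) (f : Fin k → A), g (f ∘ σ) = g f)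
    (hspan : Submodule.span ℂ (Set.range g) = ⊤)
    (hrank : Module.finrank ℂ M = (Module.finrank ℂ A + k - 1).choose k)
    {N : Type} [AddCommGroup N] [Module ℂ N]
    (G : MultilinearMap ℂ (fun _ : Fin k => A) N)
    (hG : ∀ (σ : Equiv.Perm (Fin k)) (f : Fin k → A), G (f ∘ σ) = G f) :
    ∃ L : M →ₗ[ℂ] N, ∀ f, L (g f) = G f := by
  classical
  let b := Module.finBasis ℂ A
  set m := Module.finrank ℂ A
  have hrep : ∀ s : Sym (Fin m) k, ∃ w : Fin k → Fin m, (List.ofFn w : Multiset (Fin m)) = s := by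
    rintro ⟨s, hs⟩
    induction s using Quotient.inductionOn with
    | _ l =>
      have hl : l.length = k := by simpa using hs
      subst hl
      exact ⟨l.get, by simp⟩
  choose rep hrep using hrep
  have key : ∀ w : Fin k → Fin m, ∃ s, ∃ σ : Equiv.Perm (Fin k), w = rep s ∘ σ := by
    intro w
    refine ⟨⟨(List.ofFn w : Multiset (Fin m)), by simp⟩, ?_⟩
    apply exists_perm_of_ofFn_perm
    exact Multiset.coe_eq_coe.1 (hrep _)
  have hle : ⊤ ≤ Submodule.span ℂ (Set.range fun s => g (b ∘ rep s)) := by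
    rw [← span_gen_of_span g hspan (Set.range b) b.span_eq, Submodule.span_le]
    rintro _ ⟨f, hf, rfl⟩
    choose w hw using hf
    obtain rfl : f = b ∘ w := funext fun i => (hw i).symm
    obtain ⟨s, σ, rfl⟩ := key w
    apply Submodule.subset_span
    exact ⟨s, by rw [← Function.comp_assoc, hsym]⟩
  let B := basisOfTopLeSpanOfCardEqFinrank (fun s : Sym (Fin m) k => g (b ∘ rep s)) hle
    (by rw [hrank, Sym.card_sym_eq_choose, Fintype.card_fin])
  have hB : ∀ s, B s = g (b ∘ rep s) := fun s => by simp [B]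
  refine ⟨B.constr ℂ (fun s => G (b ∘ rep s)), fun f => ?_⟩
  have : (B.constr ℂ (fun s => G (b ∘ rep s))).compMultilinearMap g = G := by
    refine Module.Basis.ext_multilinear (fun _ => b) ?_
    intro w
    obtain ⟨s, σ, rfl⟩ := key w
    have e : (fun i => b ((rep s ∘ σ) i)) = (b ∘ rep s) ∘ σ := rfl
    rw [e, LinearMap.compMultilinearMap_apply, hsym, hG, ← hB, Module.Basis.constr_basis]
  exact congrArg (fun H => H f) this

lemma exists_ext_lift [FiniteDimensional ℂ A] {k : ℕ} [FiniteDimensional ℂ M]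
    (g : AlternatingMap ℂ A M (Fin k))
    (hspan : Submodule.span ℂ (Set.range g) = ⊤)
    (hrank : Module.finrank ℂ M = (Module.finrank ℂ A).choose k) :
    ∃ e : M ≃ₗ[ℂ] (⋀[ℂ]^k A), ∀ f, e (g f) = exteriorPower.ιMulti ℂ k f := by
  let L := exteriorPower.alternatingMapLinearEquiv g
  have hL : ∀ f, L (exteriorPower.ιMulti ℂ k f) = g f := fun f => by simp [L]
  have hs : Function.Surjective L := by
    rw [← LinearMap.range_eq_top, eq_top_iff, ← hspan, Submodule.span_le]
    rintro _ ⟨f, rfl⟩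
    exact ⟨_, hL f⟩
  have hi : Function.Injective L := by
    rw [LinearMap.injective_iff_surjective_of_finrank_eq_finrank]
    · exact hs
    · rw [hrank, exteriorPower.finrank_eq]
  refine ⟨(LinearEquiv.ofBijective L ⟨hi, hs⟩).symm, fun f => ?_⟩
  rw [LinearEquiv.symm_apply_eq]
  exact (hL f).symm

lemma exists_wedge [FiniteDimensional ℂ A] {k : ℕ} [FiniteDimensional ℂ M]
    (g : AlternatingMap ℂ A M (Fin k))
    (hspan : Submodule.span ℂ (Set.range g) = ⊤)
    (hrank : Module.finrank ℂ M = (Module.finrank ℂ A).choose k)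
    {N : Type} [AddCommGroup N] [Module ℂ N] (G : AlternatingMap ℂ A N (Fin (k + 1))) :
    ∃ w : A →ₗ[ℂ] M →ₗ[ℂ] N, ∀ a f, w a (g f) = G (Matrix.vecCons a f) := by
  obtain ⟨e, he⟩ := exists_ext_lift g hspan hrank
  refine ⟨(LinearMap.lcomp ℂ N e.toLinearMap) ∘ₗ
    exteriorPower.alternatingMapLinearEquiv.toLinearMap ∘ₗ G.curryLeft, fun a f => ?_⟩
  simp [he]

/-- invariance under self-injections -/
lemma gen_inj {A M : Type} {k : ℕ} {g : (Fin k → A) → M} 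
    (hsym : ∀ (σ : Equiv.Perm (Fin k)) (f : Fin k → A), g (f ∘ σ) = g f)
    (e : Fin k → Fin k) (he : Function.Injective e) (f : Fin k → A) : g (f ∘ e) = g f :=
  hsym (Equiv.ofBijective e (Finite.injective_iff_bijective.1 he)) f

lemma exists_delta [FiniteDimensional ℂ A] {k : ℕ} [FiniteDimensional ℂ M]
    {M' : Type} [AddCommGroup M'] [Module ℂ M']
    (g : MultilinearMap ℂ (fun _ : Fin (k+1) => A) M)
    (hsym : ∀ (σ : Equiv.Perm (Fin (k+1))) (f : Fin (k+1) → A), g (f ∘ σ) = g f)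
    (hspan : Submodule.span ℂ (Set.range g) = ⊤)
    (hrank : Module.finrank ℂ M = (Module.finrank ℂ A + (k+1) - 1).choose (k+1))
    (g' : MultilinearMap ℂ (fun _ : Fin k => A) M')
    (hsym' : ∀ (σ : Equiv.Perm (Fin k)) (f : Fin k → A), g' (f ∘ σ) = g' f) :
    ∃ δ : M →ₗ[ℂ] M' ⊗[ℂ] A, ∀ f, δ (g f) = ∑ i, g' (f ∘ i.succAbove) ⊗ₜ f i := by
  let F : A →ₗ[ℂ] MultilinearMap ℂ (fun _ : Fin k => A) (M' ⊗[ℂ] A) :=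
    { toFun := fun a => ((TensorProduct.mk ℂ M' A).flip a).compMultilinearMap g'
      map_add' := fun a b => by ext; simp
      map_smul' := fun a b => by ext; simp }
  obtain ⟨L, hL⟩ := exists_lift g hsym hspan hrank
    (∑ i : Fin (k+1), (LinearMap.uncurryMid (M := fun _ => A) i F)) (by
      intro σ f
      simp only [sum_apply, LinearMap.uncurryMid_apply]
      rw [← Equiv.sum_comp σ (fun i => (F (f i)) (i.removeNth f))]
      refine Finset.sum_congr rfl fun i _ => ?_
      have : ∀ t : Fin k, ∃ u, (σ i).succAbove u = σ (i.succAbove t) := fun t =>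
        Fin.exists_succAbove_eq (fun h => Fin.succAbove_ne i t (σ.injective h))
      choose τ hτ using this
      have hτi : Function.Injective τ := by
        intro a b hab
        have := hτ a
        rw [hab, hτ b] at this
        exact (Fin.succAbove_right_injective (σ.injective this)).symm
      have e : i.removeNth (f ∘ σ) = (σ i).removeNth f ∘ τ := by
        funext t
        simp [Fin.removeNth, hτ]
      change g' (i.removeNth (f ∘ σ)) ⊗ₜ[ℂ] f (σ i) = g' ((σ i).removeNth f) ⊗ₜ[ℂ] f (σ i)
      rw [e, gen_inj hsym' _ hτi])
  refine ⟨L, fun f => ?_⟩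
  rw [hL]
  simp only [sum_apply, LinearMap.uncurryMid_apply]
  rfl

end gens
section core

lemma tensor_ext {X Y S E M : Type} [AddCommGroup S] [Module ℂ S] [AddCommGroup E] [Module ℂ E]
    [AddCommGroup M] [Module ℂ M] {g : X → S} {h : Y → E}
    (hg : Submodule.span ℂ (Set.range g) = ⊤) (hh : Submodule.span ℂ (Set.range h) = ⊤)
    {a b : S ⊗[ℂ] E →ₗ[ℂ] M} (hab : ∀ x y, a (g x ⊗ₜ h y) = b (g x ⊗ₜ h y)) : a = b := by
  have : TensorProduct.curry a = TensorProduct.curry b := by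
    refine LinearMap.ext_on hg ?_
    rintro _ ⟨x, rfl⟩
    refine LinearMap.ext_on hh ?_
    rintro _ ⟨y, rfl⟩
    simpa using hab x y
  exact TensorProduct.curry_injective this

lemma neg_one_smul_int {M : Type} [AddCommGroup M] [Module ℂ M] (n : ℕ) (x : M) :
    ((-1 : ℂ) ^ n) • x = ((-1 : ℤ) ^ n) • x := by
  rcases Nat.even_or_odd n with h | h <;> simp [h.neg_one_pow]

lemma snoc_sA_castSucc {A : Type} {k : ℕ} (f : Fin (k+1) → A) (x : A) (t : Fin (k+1)) :
    (Fin.snoc f x : Fin (k+2) → A) ∘ t.castSucc.succAbove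
      = (Fin.snoc (f ∘ t.succAbove) x : Fin (k+1) → A) := by
  funext u
  refine Fin.lastCases ?_ (fun u => ?_) u
  · simp
  · simp [Fin.castSucc_succAbove_castSucc]

lemma snoc_sA_last {A : Type} {k : ℕ} (f : Fin k → A) (x : A) :
    (Fin.snoc f x : Fin (k+1) → A) ∘ (Fin.last k).succAbove = f := by
  funext u
  simp

variable {A : Type} [AddCommGroup A] [Module ℂ A]
  {W : Type} [AddCommGroup W] [Module ℂ W]
  {S : ℕ → Type} [∀ k, AddCommGroup (S k)] [∀ k, Module ℂ (S k)]
  {E : ℕ → Type} [∀ k, AddCommGroup (E k)] [∀ k, Module ℂ (E k)]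
  (gen : ∀ k, MultilinearMap ℂ (fun _ : Fin k => A) (S k))
  (genE : ∀ j, AlternatingMap ℂ W (E j) (Fin j))
  (i : W →ₗ[ℂ] A) (p : A →ₗ[ℂ] W)

/-- Koszul differential characterisation. -/
def IsD (k j : ℕ) (d : (S k ⊗[ℂ] E (j+1)) →ₗ[ℂ] (S (k+1) ⊗[ℂ] E j)) : Prop :=
  ∀ (f : Fin k → A) (φ : Fin (j+1) → W), d (gen k f ⊗ₜ genE (j+1) φ) =
    ∑ l : Fin (j+1), ((-1 : ℂ) ^ (l : ℕ)) •
      (gen (k+1) (Fin.snoc f (i (φ l))) ⊗ₜ[ℂ] genE j (φ ∘ l.succAbove))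

/-- Homotopy characterisation. -/
def IsH (k j : ℕ) (h : (S (k+1) ⊗[ℂ] E j) →ₗ[ℂ] (S k ⊗[ℂ] E (j+1))) : Prop :=
  ∀ (f : Fin (k+1) → A) (φ : Fin j → W), h (gen (k+1) f ⊗ₜ genE j φ) =
    ∑ t : Fin (k+1), 
      (gen k (f ∘ t.succAbove) ⊗ₜ[ℂ] genE (j+1) (Matrix.vecCons (p (f t)) φ))

/-- Euler operator characterisation. -/
def IsN (k : ℕ) (N : S (k+1) →ₗ[ℂ] S (k+1)) : Prop :=
  ∀ (f : Fin (k+1) → A), N (gen (k+1) f) =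
    ∑ t : Fin (k+1), gen (k+1) (Fin.snoc (f ∘ t.succAbove) (i (p (f t))))

lemma hd_formula (hpi : ∀ x, p (i x) = x) (k j : ℕ) {d : (S k ⊗[ℂ] E (j+1)) →ₗ[ℂ] (S (k+1) ⊗[ℂ] E j)}
    (hd : IsD gen genE i k j d) {h : (S (k+1) ⊗[ℂ] E j) →ₗ[ℂ] (S k ⊗[ℂ] E (j+1))}
    (hh : IsH gen genE p k j h) (f : Fin k → A) (φ : Fin (j+1) → W) :
    h (d (gen k f ⊗ₜ genE (j+1) φ)) =
      (∑ l : Fin (j+1), ((-1 : ℂ) ^ (l : ℕ)) • ∑ t : Fin k,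
        gen k ((Fin.snoc f (i (φ l)) : Fin (k+1) → A) ∘ t.castSucc.succAbove) ⊗ₜ[ℂ]
          genE (j+1) (Matrix.vecCons (p (f t)) (φ ∘ l.succAbove)))
      + ((j : ℂ) + 1) • (gen k f ⊗ₜ[ℂ] genE (j+1) φ) := by
  have e : ((j : ℂ) + 1) • (gen k f ⊗ₜ[ℂ] genE (j+1) φ)
      = ∑ l : Fin (j+1), (gen k f ⊗ₜ[ℂ] genE (j+1) φ) := by
    rw [Finset.sum_const, Finset.card_univ, Fintype.card_fin, ← Nat.cast_smul_eq_nsmul ℂ]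
    push_cast; rfl
  rw [hd, map_sum, e, ← Finset.sum_add_distrib]
  refine Finset.sum_congr rfl fun l _ => ?_
  rw [map_smul, hh, Fin.sum_univ_castSucc, smul_add]
  congr 1
  · simp
  · rw [snoc_sA_last, Fin.snoc_last, hpi, ← TensorProduct.tmul_smul, neg_one_smul_int,
      ← AlternatingMap.map_insertNth]
    congr 2
    exact Fin.insertNth_self_removeNth l φ

lemma homotopy_zero (hspan : ∀ k, Submodule.span ℂ (Set.range (gen k)) = ⊤)
    (hspanE : ∀ k, Submodule.span ℂ (Set.range (genE k)) = ⊤)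
    (hpi : ∀ x, p (i x) = x) (j : ℕ) {d : (S 0 ⊗[ℂ] E (j+1)) →ₗ[ℂ] (S (0+1) ⊗[ℂ] E j)}
    (hd : IsD gen genE i 0 j d) {h : (S (0+1) ⊗[ℂ] E j) →ₗ[ℂ] (S 0 ⊗[ℂ] E (j+1))}
    (hh : IsH gen genE p 0 j h) : h ∘ₗ d = ((j : ℂ) + 1) • LinearMap.id := by
  refine tensor_ext (hspan 0) (hspanE _) fun f φ => ?_
  rw [LinearMap.comp_apply, hd_formula gen genE i p hpi 0 j hd hh]
  simp

lemma homotopy_succ (hspan : ∀ k, Submodule.span ℂ (Set.range (gen k)) = ⊤)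
    (hspanE : ∀ k, Submodule.span ℂ (Set.range (genE k)) = ⊤)
    (hpi : ∀ x, p (i x) = x) (k j : ℕ)
    {d : (S (k+1) ⊗[ℂ] E (j+1)) →ₗ[ℂ] (S (k+1+1) ⊗[ℂ] E j)}
    (hd : IsD gen genE i (k+1) j d)
    {h : (S (k+1+1) ⊗[ℂ] E j) →ₗ[ℂ] (S (k+1) ⊗[ℂ] E (j+1))}
    (hh : IsH gen genE p (k+1) j h)
    {d' : (S k ⊗[ℂ] E (j+1+1)) →ₗ[ℂ] (S (k+1) ⊗[ℂ] E (j+1))}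
    (hd' : IsD gen genE i k (j+1) d')
    {h' : (S (k+1) ⊗[ℂ] E (j+1)) →ₗ[ℂ] (S k ⊗[ℂ] E (j+1+1))}
    (hh' : IsH gen genE p k (j+1) h') 
    {N : S (k+1) →ₗ[ℂ] S (k+1)} (hN : IsN gen i p k N) :
    d' ∘ₗ h' + h ∘ₗ d = LinearMap.rTensor _ N + ((j : ℂ) + 1) • LinearMap.id := by
  refine tensor_ext (hspan _) (hspanE _) fun f φ => ?_
  simp only [LinearMap.add_apply, LinearMap.comp_apply, hd_formula gen genE i p hpi _ j hd hh,
    LinearMap.smul_apply, LinearMap.id_apply, LinearMap.rTensor_tmul]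
  rw [← add_assoc]
  congr 1
  rw [hh', map_sum, hN, TensorProduct.sum_tmul]
  simp_rw [hd' _ _, snoc_sA_castSucc, Finset.smul_sum]
  rw [Finset.sum_comm (s := (Finset.univ : Finset (Fin (j+1)))), ← Finset.sum_add_distrib]
  refine Finset.sum_congr rfl fun t _ => ?_
  rw [Fin.sum_univ_succ, add_assoc, ← Finset.sum_add_distrib, Finset.sum_eq_zero, add_zero]
  · simp
    rfl
  · intro l _
    have : (Matrix.vecCons (p (f t)) φ) ∘ l.succ.succAbove
        = Matrix.vecCons (p (f t)) (φ ∘ l.succAbove) := by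
      funext u
      refine Fin.cases ?_ (fun u => ?_) u <;> simp
    rw [this]
    simp [pow_succ]

lemma dd_zero (hspan : ∀ k, Submodule.span ℂ (Set.range (gen k)) = ⊤)
    (hspanE : ∀ k, Submodule.span ℂ (Set.range (genE k)) = ⊤)
    (hsym : ∀ k (σ : Equiv.Perm (Fin k)) (f : Fin k → A), gen k (f ∘ σ) = gen k f)
    (mul : ∀ k, S k →ₗ[ℂ] A →ₗ[ℂ] S (k + 1))
    (hmul : ∀ k (f : Fin k → A) (ψ : A), mul k (gen k f) ψ = gen (k + 1) (Fin.snoc f ψ))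
    (k j : ℕ)
    {d : (S (k+1) ⊗[ℂ] E (j+1)) →ₗ[ℂ] (S (k+1+1) ⊗[ℂ] E j)}
    (hd : IsD gen genE i (k+1) j d)
    {d' : (S k ⊗[ℂ] E (j+1+1)) →ₗ[ℂ] (S (k+1) ⊗[ℂ] E (j+1))}
    (hd' : IsD gen genE i k (j+1) d') : d ∘ₗ d' = 0 := by
  refine tensor_ext (hspan _) (hspanE _) fun f φ => ?_
  let F : W →ₗ[ℂ] W →ₗ[ℂ] W [⋀^Fin j]→ₗ[ℂ] (S (k+1+1) ⊗[ℂ] E j) :=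
    LinearMap.mk₂ ℂ (fun a b => (TensorProduct.mk ℂ (S (k+1+1)) (E j)
        (mul (k+1) (mul k (gen k f) (i a)) (i b))).compAlternatingMap (genE j))
      (fun a a' b => by ext; simp [TensorProduct.add_tmul])
      (fun c a b => by ext; simp [TensorProduct.smul_tmul'])
      (fun a b b' => by ext; simp [TensorProduct.add_tmul])
      (fun c a b => by ext; simp [TensorProduct.smul_tmul'])
  have hF : ∀ x y, F x y = F y x := by
    intro x y
    ext v
    simp only [F, LinearMap.mk₂_apply, hmul, LinearMap.compAlternatingMap_apply]
    congr 2
    rw [← hsym _ (Equiv.swap (Fin.last (k+1)) (Fin.last k).castSucc)]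
    congr 1
    funext u
    refine Fin.lastCases ?_ (fun u => Fin.lastCases ?_ (fun u => ?_) u) u
    · simp
    · simp
    · have h1 : u.castSucc.castSucc ≠ Fin.last (k+1) := Fin.castSucc_ne_last _
      have h2 : u.castSucc.castSucc ≠ (Fin.last k).castSucc := by
        intro h
        exact Fin.castSucc_ne_last _ (Fin.castSucc_injective _ h)
      simp [Equiv.swap_apply_of_ne_of_ne h1 h2]
  have h0 := congrArg (fun G => G φ)
    (AlternatingMap.alternatizeUncurryFin_alternatizeUncurryFinLM_comp_of_symmetric hF)
  simp only [AlternatingMap.alternatizeUncurryFin_apply, LinearMap.comp_apply,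
    AlternatingMap.alternatizeUncurryFinLM_apply, AlternatingMap.zero_apply] at h0
  rw [LinearMap.comp_apply, hd', map_sum, LinearMap.zero_apply, ← h0]
  refine Finset.sum_congr rfl fun l _ => ?_
  rw [map_smul, hd, neg_one_smul_int]
  congr 1
  refine Finset.sum_congr rfl fun m _ => ?_
  rw [neg_one_smul_int]
  congr 1
  simp only [F, LinearMap.mk₂_apply, hmul, LinearMap.compAlternatingMap_apply]
  rfl

lemma T_surj (hspan : ∀ k, Submodule.span ℂ (Set.range (gen k)) = ⊤)
    (hsym : ∀ k (σ : Equiv.Perm (Fin k)) (f : Fin k → A), gen k (f ∘ σ) = gen k f)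
    (hpi : ∀ x, p (i x) = x) (k j : ℕ)
    {N : S (k+1) →ₗ[ℂ] S (k+1)} (hN : IsN gen i p k N) (X : Type) [AddCommGroup X] [Module ℂ X] :
    Function.Surjective (LinearMap.rTensor X N + ((j : ℂ) + 1) •
      (LinearMap.id : S (k+1) ⊗[ℂ] X →ₗ[ℂ] S (k+1) ⊗[ℂ] X)) := by
  have hP : Submodule.span ℂ {a : A | i (p a) = a ∨ p a = 0} = ⊤ := by
    rw [eq_top_iff]
    intro a _
    have : a = i (p a) + (a - i (p a)) := by abel
    rw [this]
    refine add_mem (Submodule.subset_span (Or.inl ?_)) (Submodule.subset_span (Or.inr ?_))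
    · rw [hpi]
    · rw [map_sub, hpi, sub_self]
  have hs := span_gen_of_span (gen (k+1)) (hspan _) _ hP
  rw [← LinearMap.range_eq_top, eq_top_iff]
  set R := LinearMap.range (LinearMap.rTensor X N + ((j : ℂ) + 1) •
      (LinearMap.id : S (k+1) ⊗[ℂ] X →ₗ[ℂ] S (k+1) ⊗[ℂ] X))
  rintro z -
  induction z using TensorProduct.induction_on with
  | zero => exact zero_mem _
  | add x y hx hy => exact add_mem hx hy
  | tmul s x =>
    have hmem : s ∈ Submodule.span ℂ {x | ∃ f : Fin (k+1) → A,
      (∀ t, f t ∈ {a : A | i (p a) = a ∨ p a = 0}) ∧ gen (k+1) f = x} := hs ▸ Submodule.mem_top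
    induction hmem using Submodule.span_induction with
    | zero => rw [TensorProduct.zero_tmul]; exact zero_mem _
    | add a b _ _ ha hb => rw [TensorProduct.add_tmul]; exact add_mem ha hb
    | smul c a _ ha => rw [← TensorProduct.smul_tmul']; exact R.smul_mem _ ha
    | mem a ha =>
      obtain ⟨f, hf, rfl⟩ := ha
      have : ∃ m : ℕ, N (gen (k+1) f) = (m : ℂ) • gen (k+1) f := by
        rw [hN]
        have : ∀ t, ∃ m : ℕ, gen (k+1) (Fin.snoc (f ∘ t.succAbove) (i (p (f t))))
            = (m : ℂ) • gen (k+1) f := by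
          intro t
          rcases hf t with h | h
          · refine ⟨1, ?_⟩
            rw [h]
            have e : (Fin.snoc (f ∘ t.succAbove) (f t) : Fin (k+1) → A)
                = f ∘ (Fin.snoc t.succAbove t : Fin (k+1) → Fin (k+1)) := by
              funext u
              refine Fin.lastCases ?_ (fun u => ?_) u <;> simp
            rw [e, gen_inj (hsym _)]
            · simp
            · intro u v
              refine Fin.lastCases ?_ (fun u => ?_) u <;>
              refine Fin.lastCases ?_ (fun v => ?_) v <;> simp [Fin.succAbove_ne]
          · refine ⟨0, ?_⟩
            rw [h, map_zero]
            simp only [Nat.cast_zero, zero_smul]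
            exact (gen (k+1)).map_coord_zero (Fin.last k) (by simp)
        choose m hm using this
        refine ⟨∑ t, m t, ?_⟩
        simp [hm, Finset.sum_smul]
      obtain ⟨m, hm⟩ := this
      have hne : (m : ℂ) + ((j : ℂ) + 1) ≠ 0 := by exact_mod_cast (by omega : m + (j + 1) ≠ 0)
      refine ⟨((m : ℂ) + ((j : ℂ) + 1))⁻¹ • (gen (k+1) f ⊗ₜ x), ?_⟩
      rw [map_smul, inv_smul_eq_iff₀ hne]
      simp only [LinearMap.add_apply, LinearMap.rTensor_tmul, hm, LinearMap.smul_apply,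
        LinearMap.id_apply, add_smul, TensorProduct.smul_tmul']

lemma exists_H (k j : ℕ) (δ : S (k+1) →ₗ[ℂ] S k ⊗[ℂ] A)
    (hδ : ∀ f, δ (gen (k+1) f) = ∑ i, gen k (f ∘ i.succAbove) ⊗ₜ f i)
    (w : W →ₗ[ℂ] E j →ₗ[ℂ] E (j+1))
    (hw : ∀ a f, w a (genE j f) = genE (j+1) (Matrix.vecCons a f)) :
    ∃ h, IsH gen genE p k j h := by
  refine ⟨LinearMap.lTensor (S k) (TensorProduct.lift (w ∘ₗ p)) ∘ₗ
    (TensorProduct.assoc ℂ (S k) A (E j)).toLinearMap ∘ₗ LinearMap.rTensor (E j) δ, ?_⟩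
  intro f φ
  simp [hδ, TensorProduct.sum_tmul, hw]

lemma exists_N (k : ℕ) (δ : S (k+1) →ₗ[ℂ] S k ⊗[ℂ] A)
    (hδ : ∀ f, δ (gen (k+1) f) = ∑ i, gen k (f ∘ i.succAbove) ⊗ₜ f i)
    (mul : ∀ k, S k →ₗ[ℂ] A →ₗ[ℂ] S (k + 1))
    (hmul : ∀ k (f : Fin k → A) (ψ : A), mul k (gen k f) ψ = gen (k + 1) (Fin.snoc f ψ)) :
    ∃ N, IsN gen i p k N := by
  refine ⟨TensorProduct.lift (mul k) ∘ₗ LinearMap.lTensor (S k) (i ∘ₗ p) ∘ₗ δ, ?_⟩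
  intro f
  simp [hδ, hmul]

lemma core_exact [∀ k, FiniteDimensional ℂ (S k)] [∀ k, FiniteDimensional ℂ (E k)]
    (hspan : ∀ k, Submodule.span ℂ (Set.range (gen k)) = ⊤)
    (hspanE : ∀ k, Submodule.span ℂ (Set.range (genE k)) = ⊤)
    (hsym : ∀ k (σ : Equiv.Perm (Fin k)) (f : Fin k → A), gen k (f ∘ σ) = gen k f)
    (hpi : ∀ x, p (i x) = x)
    (mul : ∀ k, S k →ₗ[ℂ] A →ₗ[ℂ] S (k + 1))
    (hmul : ∀ k (f : Fin k → A) (ψ : A), mul k (gen k f) ψ = gen (k + 1) (Fin.snoc f ψ))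
    (hH : ∀ k j, ∃ h, IsH gen genE p k j h) (hN : ∀ k, ∃ N, IsN gen i p k N)
    (k j : ℕ)
    {d : (S (k+1) ⊗[ℂ] E (j+1)) →ₗ[ℂ] (S (k+1+1) ⊗[ℂ] E j)}
    (hd : IsD gen genE i (k+1) j d)
    {d' : (S k ⊗[ℂ] E (j+1+1)) →ₗ[ℂ] (S (k+1) ⊗[ℂ] E (j+1))}
    (hd' : IsD gen genE i k (j+1) d') : Function.Exact d' d := by
  obtain ⟨h, hh⟩ := hH (k+1) j
  obtain ⟨h', hh'⟩ := hH k (j+1)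
  obtain ⟨N, hN⟩ := hN k
  have hT := homotopy_succ gen genE i p hspan hspanE hpi k j hd hh hd' hh' hN
  have hs := T_surj gen i p hspan hsym hpi k j hN (E (j+1))
  rw [← hT] at hs
  have hdd := dd_zero gen genE i hspan hspanE hsym mul hmul k j hd hd'
  have hinj := LinearMap.injective_iff_surjective.2 hs
  set T := d' ∘ₗ h' + h ∘ₗ d with hTdef
  have hTx : ∀ x, d x = 0 → T x = d' (h' x) := by
    intro x hx
    simp [hTdef, hx]
  have hmaps : ∀ x ∈ LinearMap.ker d, T x ∈ LinearMap.ker d := by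
    intro x hx
    rw [hTx x hx]
    exact LinearMap.congr_fun hdd _
  intro x
  constructor
  · intro hx
    have hri : Function.Injective (T.restrict hmaps) := by
      intro a b hab
      apply Subtype.ext
      apply hinj
      exact congrArg Subtype.val hab
    obtain ⟨y, hy⟩ := LinearMap.injective_iff_surjective.1 hri ⟨x, hx⟩
    refine ⟨h' y, ?_⟩
    rw [← hTx y y.2]
    exact congrArg Subtype.val hy
  · rintro ⟨y, rfl⟩
    exact LinearMap.congr_fun hdd y

lemma core_inj [∀ k, FiniteDimensional ℂ (S k)] [∀ k, FiniteDimensional ℂ (E k)]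
    (hspan : ∀ k, Submodule.span ℂ (Set.range (gen k)) = ⊤)
    (hspanE : ∀ k, Submodule.span ℂ (Set.range (genE k)) = ⊤)
    (hsym : ∀ k (σ : Equiv.Perm (Fin k)) (f : Fin k → A), gen k (f ∘ σ) = gen k f)
    (hpi : ∀ x, p (i x) = x)
    (hH : ∀ k j, ∃ h, IsH gen genE p k j h) (hN : ∀ k, ∃ N, IsN gen i p k N)
    (hDe : ∀ k j, ∃ d, IsD gen genE i k j d)
    (k j : ℕ)
    {d : (S k ⊗[ℂ] E (j+1)) →ₗ[ℂ] (S (k+1) ⊗[ℂ] E j)}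
    (hd : IsD gen genE i k j d)
    (hE : k = 0 ∨ Subsingleton (E (j+1+1))) : Function.Injective d := by
  rw [injective_iff_map_eq_zero]
  intro x hx
  obtain ⟨h, hh⟩ := hH k j
  cases k with
  | zero =>
    have := LinearMap.congr_fun (homotopy_zero gen genE i p hspan hspanE hpi j hd hh) x
    have hne : (j : ℂ) + 1 ≠ 0 := by exact_mod_cast j.succ_ne_zero
    simp only [LinearMap.comp_apply, hx, map_zero, LinearMap.smul_apply, LinearMap.id_apply] at this
    exact (smul_eq_zero.1 this.symm).resolve_left hne
  | succ k =>
    have hsub : Subsingleton (E (j+1+1)) := hE.resolve_left (by omega)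
    obtain ⟨h', hh'⟩ := hH k (j+1)
    obtain ⟨N, hN⟩ := hN k
    obtain ⟨d', hd'⟩ := hDe k (j+1)
    have hT := homotopy_succ gen genE i p hspan hspanE hpi k j hd hh hd' hh' hN
    have hs := T_surj gen i p hspan hsym hpi k j hN (E (j+1))
    rw [← hT] at hs
    apply LinearMap.injective_iff_surjective.2 hs
    have h0 : h' x = 0 := by
      have hall : ∀ z : S k ⊗[ℂ] E (j+1+1), z = 0 := by
        intro z
        induction z using TensorProduct.induction_on with
        | zero => rfl
        | add x y hx hy => rw [hx, hy, add_zero]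
        | tmul s e => rw [Subsingleton.elim e 0, TensorProduct.tmul_zero]
      exact hall _
    simp [hx, h0]


/-- Koszul differential characterisation, with degree equalities. -/
def IsD' (a b j : ℕ) (hab : a + 1 = b) (d : (S a ⊗[ℂ] E (j+1)) →ₗ[ℂ] (S b ⊗[ℂ] E j)) : Prop :=
  ∀ (f : Fin a → A) (φ : Fin (j+1) → W), d (gen a f ⊗ₜ genE (j+1) φ) =
    ∑ l : Fin (j+1), ((-1 : ℂ) ^ (l : ℕ)) •
      (gen b (fun u => (Fin.snoc f (i (φ l)) : Fin (a+1) → A) (Fin.cast hab.symm u)) ⊗ₜ[ℂ]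
        genE j (φ ∘ l.succAbove))

lemma isD_of_isD' (a j : ℕ) (d : (S a ⊗[ℂ] E (j+1)) →ₗ[ℂ] (S (a+1) ⊗[ℂ] E j))
    (hd : IsD' gen genE i a (a+1) j rfl d) : IsD gen genE i a j d := hd

lemma exists_of_isD' (a b k j : ℕ) (hab : a + 1 = b)
    (d : (S a ⊗[ℂ] E (j+1)) →ₗ[ℂ] (S b ⊗[ℂ] E j))
    (hd : IsD' gen genE i a b j hab d) (hk : a = k) : ∃ d, IsD gen genE i k j d := by
  subst hk hab
  exact ⟨d, hd⟩

lemma exact' 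
    (hcore : ∀ (k j : ℕ)
      {d : (S (k+1) ⊗[ℂ] E (j+1)) →ₗ[ℂ] (S (k+1+1) ⊗[ℂ] E j)}
      (_ : IsD gen genE i (k+1) j d)
      {d' : (S k ⊗[ℂ] E (j+1+1)) →ₗ[ℂ] (S (k+1) ⊗[ℂ] E (j+1))}
      (_ : IsD gen genE i k (j+1) d'), Function.Exact d' d) 
    (a b c j : ℕ) (hab : a + 1 = b) (hbc : b + 1 = c)
    (d : (S b ⊗[ℂ] E (j+1)) →ₗ[ℂ] (S c ⊗[ℂ] E j))
    (hd : IsD' gen genE i b c j hbc d)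
    (d' : (S a ⊗[ℂ] E (j+1+1)) →ₗ[ℂ] (S b ⊗[ℂ] E (j+1)))
    (hd' : IsD' gen genE i a b (j+1) hab d') : Function.Exact d' d := by
  subst hab hbc
  exact hcore a j hd hd'

lemma inj' (P : ℕ → ℕ → Prop)
    (hcore : ∀ (k j : ℕ)
      {d : (S k ⊗[ℂ] E (j+1)) →ₗ[ℂ] (S (k+1) ⊗[ℂ] E j)}
      (_ : IsD gen genE i k j d) (_ : P k j), Function.Injective d) 
    (a b j : ℕ) (hab : a + 1 = b)
    (d : (S a ⊗[ℂ] E (j+1)) →ₗ[ℂ] (S b ⊗[ℂ] E j))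
    (hd : IsD' gen genE i a b j hab d) (hP : P a j) : Function.Injective d := by
  subst hab
  exact hcore a j hd hP

lemma end_exact {B : Type} [AddCommGroup B] [Module ℂ B] {M : Type} [AddCommGroup M] [Module ℂ M]
    (hspan : ∀ k, Submodule.span ℂ (Set.range (gen k)) = ⊤)
    (hspanE : ∀ k, Submodule.span ℂ (Set.range (genE k)) = ⊤)
    (hsym : ∀ k (σ : Equiv.Perm (Fin k)) (f : Fin k → A), gen k (f ∘ σ) = gen k f)
    (q : A →ₗ[ℂ] B) (σ : B →ₗ[ℂ] A) (hqσ : ∀ b, q (σ b) = b)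
    (hex : ∀ a, q a = 0 ↔ ∃ w, i w = a)
    (a n : ℕ) (han : a + 1 = n)
    (g : MultilinearMap ℂ (fun _ : Fin n => B) M)
    (res : S n →ₗ[ℂ] M) (hres : ∀ f, res (gen n f) = g (fun t => q (f t)))
    (sec : M →ₗ[ℂ] S n) (hsec : ∀ f, sec (g f) = gen n (fun t => σ (f t)))
    (hrs : ∀ x, res (sec x) = x)
    (d : (S a ⊗[ℂ] E 1) →ₗ[ℂ] S n)
    (hd : ∀ (f : Fin a → A) (φ : Fin 1 → W), d (gen a f ⊗ₜ genE 1 φ) =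
      gen n (fun u => (Fin.snoc f (i (φ 0)) : Fin (a+1) → A) (Fin.cast han.symm u))) :
    Function.Exact d res := by
  subst han
  have h1 : res ∘ₗ d = 0 := by
    refine tensor_ext (hspan _) (hspanE _) fun f φ => ?_
    rw [LinearMap.comp_apply, hd, hres, LinearMap.zero_apply]
    refine g.map_coord_zero (Fin.last a) ?_
    have : q (i (φ 0)) = 0 := (hex _).2 ⟨_, rfl⟩
    simpa using this
  have hP : Submodule.span ℂ {x : A | (∃ w, i w = x) ∨ (∃ b, σ b = x)} = ⊤ := by
    rw [eq_top_iff]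
    intro x _
    have : x = (x - σ (q x)) + σ (q x) := by abel
    rw [this]
    refine add_mem (Submodule.subset_span (Or.inl ?_)) (Submodule.subset_span (Or.inr ⟨_, rfl⟩))
    rw [← hex, map_sub, hqσ, sub_self]
  have h2 : LinearMap.range d ⊔ LinearMap.range sec = ⊤ := by
    rw [eq_top_iff, ← span_gen_of_span (gen (a+1)) (hspan _) _ hP, Submodule.span_le]
    rintro _ ⟨f, hf, rfl⟩
    by_cases hall : ∀ t, ∃ b, σ b = f t
    · choose b hb using hall
      refine Submodule.mem_sup_right ⟨g b, ?_⟩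
      rw [hsec]
      congr 1
      exact funext hb
    · push Not at hall
      obtain ⟨t, ht⟩ := hall
      obtain ⟨w, hw⟩ := (hf t).resolve_right (fun ⟨b, hb⟩ => ht b hb)
      refine Submodule.mem_sup_left ⟨gen a (f ∘ t.succAbove) ⊗ₜ genE 1 (fun _ => w), ?_⟩
      rw [hd, hw]
      have e : (fun u => (Fin.snoc (f ∘ t.succAbove) (f t) : Fin (a+1) → A) (Fin.cast rfl u))
          = f ∘ (Fin.snoc t.succAbove t : Fin (a+1) → Fin (a+1)) := by
        funext u
        refine Fin.lastCases ?_ (fun u => ?_) u <;> simp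
      rw [e, gen_inj (hsym _)]
      intro u v
      refine Fin.lastCases ?_ (fun u => ?_) u <;>
      refine Fin.lastCases ?_ (fun v => ?_) v <;> simp [Fin.succAbove_ne]
  intro x
  constructor
  · intro hx
    have hm : x ∈ LinearMap.range d ⊔ LinearMap.range sec := h2 ▸ Submodule.mem_top
    obtain ⟨_, ⟨y, rfl⟩, _, ⟨z, rfl⟩, rfl⟩ := Submodule.mem_sup.1 hm
    have h3 : res (d y) = 0 := LinearMap.congr_fun h1 y
    rw [map_add, h3, hrs, zero_add] at hx
    subst hx
    exact ⟨y, by simp⟩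
  · rintro ⟨y, rfl⟩
    exact LinearMap.congr_fun h1 y

end core
end KoszulAux


theorem koszul_complex_of_ses_is_exact
    (V₁ V₂ V₃ : Type)
    [AddCommGroup V₁] [Module ℂ V₁] [FiniteDimensional ℂ V₁]
    [AddCommGroup V₂] [Module ℂ V₂] [FiniteDimensional ℂ V₂]
    [AddCommGroup V₃] [Module ℂ V₃] [FiniteDimensional ℂ V₃]
    (ι : V₁ →ₗ[ℂ] V₂) (π : V₂ →ₗ[ℂ] V₃)
    (hι : Function.Injective ι) (hπ : Function.Surjective π)
    (hexact : LinearMap.range ι = LinearMap.ker π)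
    -- symmetric powers of V₂* :
    (S₂ : ℕ → Type) [∀ k, AddCommGroup (S₂ k)] [∀ k, Module ℂ (S₂ k)]
    [∀ k, FiniteDimensional ℂ (S₂ k)]
    (gen₂ : ∀ k, MultilinearMap ℂ (fun _ : Fin k => Module.Dual ℂ V₂) (S₂ k))
    (hsym₂ : ∀ k (σ : Equiv.Perm (Fin k)) (f : Fin k → Module.Dual ℂ V₂),
      gen₂ k (f ∘ σ) = gen₂ k f)
    (hspan₂ : ∀ k, Submodule.span ℂ (Set.range (gen₂ k)) = ⊤)
    (hrank₂ : ∀ k, Module.finrank ℂ (S₂ k) =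
      (Module.finrank ℂ V₂ + k - 1).choose k)
    -- symmetric powers of V₁* :
    (S₁ : ℕ → Type) [∀ k, AddCommGroup (S₁ k)] [∀ k, Module ℂ (S₁ k)]
    [∀ k, FiniteDimensional ℂ (S₁ k)]
    (gen₁ : ∀ k, MultilinearMap ℂ (fun _ : Fin k => Module.Dual ℂ V₁) (S₁ k))
    (hsym₁ : ∀ k (σ : Equiv.Perm (Fin k)) (f : Fin k → Module.Dual ℂ V₁),
      gen₁ k (f ∘ σ) = gen₁ k f)
    (hspan₁ : ∀ k, Submodule.span ℂ (Set.range (gen₁ k)) = ⊤)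
    (hrank₁ : ∀ k, Module.finrank ℂ (S₁ k) =
      (Module.finrank ℂ V₁ + k - 1).choose k)
    -- exterior powers of V₃* :
    (E : ℕ → Type) [∀ j, AddCommGroup (E j)] [∀ j, Module ℂ (E j)]
    [∀ j, FiniteDimensional ℂ (E j)]
    (genE : ∀ j, AlternatingMap ℂ (Module.Dual ℂ V₃) (E j) (Fin j))
    (hspanE : ∀ j, Submodule.span ℂ (Set.range (genE j)) = ⊤)
    (hrankE : ∀ j, Module.finrank ℂ (E j) = (Module.finrank ℂ V₃).choose j)
    -- transport along equalities of symmetric degrees: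
    (cast₂ : ∀ a b : ℕ, a = b → (S₂ a ≃ₗ[ℂ] S₂ b))
    (hcast₂ : ∀ (a b : ℕ) (h : a = b) (f : Fin a → Module.Dual ℂ V₂),
      cast₂ a b h (gen₂ a f) = gen₂ b fun i => f (Fin.cast h.symm i))
    -- multiplication by a linear form:
    (mul : ∀ k, S₂ k →ₗ[ℂ] Module.Dual ℂ V₂ →ₗ[ℂ] S₂ (k + 1))
    (hmul : ∀ k (f : Fin k → Module.Dual ℂ V₂) (ψ : Module.Dual ℂ V₂),
      mul k (gen₂ k f) ψ = gen₂ (k + 1) (Fin.snoc f ψ))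
    -- identification of ∧⁰V₃* with ℂ:
    (e0 : E 0 →ₗ[ℂ] ℂ) (he0 : e0 (genE 0 ![]) = 1)
    -- the Koszul differentials:
    (D : ∀ n j : ℕ, (S₂ (n - (j + 1)) ⊗[ℂ] E (j + 1)) →ₗ[ℂ] (S₂ (n - j) ⊗[ℂ] E j))
    (hD : ∀ (n j : ℕ) (hj : j + 1 ≤ n)
      (f : Fin (n - (j + 1)) → Module.Dual ℂ V₂) (φ : Fin (j + 1) → Module.Dual ℂ V₃),
      D n j (gen₂ (n - (j + 1)) f ⊗ₜ[ℂ] genE (j + 1) φ) =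
        ∑ i : Fin (j + 1), ((-1 : ℂ) ^ (i : ℕ)) •
          ((cast₂ (n - (j + 1) + 1) (n - j) (by omega)
              (mul (n - (j + 1)) (gen₂ (n - (j + 1)) f) (π.dualMap (φ i)))) ⊗ₜ[ℂ]
            genE j fun t => φ (i.succAbove t)))
    -- the augmentation S^nV₂* ⊗ ∧⁰V₃* ≅ S^nV₂* :
    (ε : ∀ n : ℕ, (S₂ (n - 0) ⊗[ℂ] E 0) →ₗ[ℂ] S₂ n)
    (hε : ∀ (n : ℕ) (x : S₂ (n - 0)) (e : E 0), ε n (x ⊗ₜ[ℂ] e) = e0 e • x)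
    -- restriction of polynomial functions:
    (res : ∀ n : ℕ, S₂ n →ₗ[ℂ] S₁ n)
    (hres : ∀ (n : ℕ) (f : Fin n → Module.Dual ℂ V₂),
      res n (gen₂ n f) = gen₁ n fun i => ι.dualMap (f i)) :
    -- CONCLUSION: the Koszul complex is exact for every n ≥ 0.
    ∀ n : ℕ,
      Function.Surjective (res n) ∧
      (1 ≤ n → Function.Exact ((ε n) ∘ₗ (D n 0)) (res n)) ∧
      (∀ j : ℕ, j + 2 ≤ min n (Module.finrank ℂ V₃) →
        Function.Exact (D n (j + 1)) (D n j)) ∧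
      (∀ j : ℕ, j + 1 = min n (Module.finrank ℂ V₃) →
        Function.Injective (D n j)) ∧
      (min n (Module.finrank ℂ V₃) = 0 → Function.Injective (res n)) := by
  have hspan₁' := hspan₁
  let A := Module.Dual ℂ V₂
  have hi : Function.Injective π.dualMap := LinearMap.dualMap_injective_of_surjective hπ
  have hq : Function.Surjective ι.dualMap := LinearMap.dualMap_surjective_of_injective hι
  obtain ⟨p, hp⟩ := LinearMap.exists_leftInverse_of_injective π.dualMap (LinearMap.ker_eq_bot.2 hi)
  obtain ⟨σ, hσ⟩ := LinearMap.exists_rightInverse_of_surjective ι.dualMap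
    (LinearMap.range_eq_top.2 hq)
  have hpi : ∀ x, p (π.dualMap x) = x := fun x => LinearMap.congr_fun hp x
  have hqσ : ∀ b, ι.dualMap (σ b) = b := fun b => LinearMap.congr_fun hσ b
  have hex : ∀ a, ι.dualMap a = 0 ↔ ∃ w, π.dualMap w = a := by
    intro a
    have h1 : LinearMap.range π.dualMap = LinearMap.ker ι.dualMap := by
      rw [LinearMap.range_dualMap_eq_dualAnnihilator_ker, LinearMap.ker_dualMap_eq_dualAnnihilator_range,
        hexact]
    rw [← LinearMap.mem_ker, ← h1, LinearMap.mem_range]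
  have hδ : ∀ k, ∃ δ : S₂ (k+1) →ₗ[ℂ] S₂ k ⊗[ℂ] Module.Dual ℂ V₂, ∀ f,
      δ (gen₂ (k+1) f) = ∑ i, gen₂ k (f ∘ i.succAbove) ⊗ₜ f i := fun k =>
    KoszulAux.exists_delta (gen₂ (k+1)) (hsym₂ _) (hspan₂ _)
      (by rw [hrank₂, Subspace.dual_finrank_eq]) (gen₂ k) (hsym₂ _)
  have hH : ∀ k j, ∃ h, KoszulAux.IsH gen₂ genE p k j h := by
    intro k j
    obtain ⟨δ, hδ⟩ := hδ k
    obtain ⟨w, hw⟩ := KoszulAux.exists_wedge (genE j) (hspanE j)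
      (by rw [hrankE, Subspace.dual_finrank_eq]) (genE (j+1))
    exact KoszulAux.exists_H gen₂ genE p k j δ hδ w hw
  have hN : ∀ k, ∃ N, KoszulAux.IsN gen₂ π.dualMap p k N := by
    intro k
    obtain ⟨δ, hδ⟩ := hδ k
    exact KoszulAux.exists_N gen₂ π.dualMap p k δ hδ mul hmul
  have hD' : ∀ (n j : ℕ) (hj : j + 1 ≤ n),
      KoszulAux.IsD' gen₂ genE π.dualMap (n - (j+1)) (n - j) j (by omega) (D n j) := by
    intro n j hj f φ
    rw [hD n j hj]
    refine Finset.sum_congr rfl fun l _ => ?_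
    rw [hmul, hcast₂]
    rfl
  have hDe : ∀ k j, ∃ d, KoszulAux.IsD gen₂ genE π.dualMap k j d := by
    intro k j
    exact KoszulAux.exists_of_isD' gen₂ genE π.dualMap _ _ k j _ _ (hD' (k + (j + 1)) j (by omega))
      (by omega)
  intro n
  obtain ⟨sec, hsec⟩ := KoszulAux.exists_lift (gen₁ n) (hsym₁ n) (hspan₁ n)
    (by rw [hrank₁, Subspace.dual_finrank_eq])
    ((gen₂ n).compLinearMap (fun _ => σ)) (by
      intro τ f
      exact hsym₂ n τ (fun t => σ (f t)))
  have hsec' : ∀ f, sec (gen₁ n f) = gen₂ n (fun t => σ (f t)) := hsec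
  have hrs : ∀ x, res n (sec x) = x := by
    have : res n ∘ₗ sec = LinearMap.id := by
      refine LinearMap.ext_on (hspan₁ n) ?_
      rintro _ ⟨f, rfl⟩
      rw [LinearMap.comp_apply, hsec', hres]
      simp only [hqσ]
      rfl
    exact fun x => LinearMap.congr_fun this x
  refine ⟨fun x => ⟨_, hrs x⟩, ?_, ?_, ?_, ?_⟩
  · intro hn
    refine KoszulAux.end_exact gen₂ genE π.dualMap hspan₂ hspanE hsym₂ ι.dualMap σ hqσ hex
      (n - (0 + 1)) n (by omega) (gen₁ n) (res n) (hres n) sec hsec' hrs _ ?_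
    intro f φ
    rw [LinearMap.comp_apply, hD' n 0 hn f φ]
    rw [Fin.sum_univ_one, map_smul, hε]
    have : (φ ∘ (0 : Fin 1).succAbove) = ![] := Subsingleton.elim _ _
    rw [this, he0]
    simp
  · intro j hj
    exact KoszulAux.exact' gen₂ genE π.dualMap
      (KoszulAux.core_exact gen₂ genE π.dualMap p hspan₂ hspanE hsym₂ hpi mul hmul hH hN)
      _ _ _ j _ _ _ (hD' n j (by omega)) _ (hD' n (j+1) (by omega))
  · intro j hj
    refine KoszulAux.inj' gen₂ genE π.dualMap _
      (KoszulAux.core_inj gen₂ genE π.dualMap p hspan₂ hspanE hsym₂ hpi hH hN hDe)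
      _ _ j _ _ (hD' n j (by omega)) ?_
    by_cases h : n = j + 1
    · left; omega
    · right
      refine (Module.finrank_zero_iff (R := ℂ)).1 ?_
      rw [hrankE]
      apply Nat.choose_eq_zero_of_lt
      omega
  · intro h0
    have hfix : ∀ f : Fin n → Module.Dual ℂ V₂, (fun t => σ (ι.dualMap (f t))) = f := by
      rcases Nat.eq_zero_or_pos n with h | h
      · subst h
        exact fun f => Subsingleton.elim _ _
      · have hd : Module.finrank ℂ V₃ = 0 := by omega
        have hs : Subsingleton V₃ := Module.finrank_zero_iff.1 hd
        have hqi : ∀ a, ι.dualMap a = 0 → a = 0 := by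
          intro a ha
          obtain ⟨w, rfl⟩ := (hex a).1 ha
          ext v
          rw [LinearMap.dualMap_apply, Subsingleton.elim (π v) 0, map_zero]
          rfl
        intro f
        funext t
        rw [← sub_eq_zero]
        apply hqi
        rw [map_sub, hqσ, sub_self]
    have hsr : sec ∘ₗ res n = LinearMap.id := by
      refine LinearMap.ext_on (hspan₂ n) ?_
      rintro _ ⟨f, rfl⟩
      rw [LinearMap.comp_apply, hres, hsec', hfix]
      rfl
    exact Function.LeftInverse.injective (g := sec) fun x => LinearMap.congr_fun hsr x
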